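/- Let R be a right ideal of A₁ with R ⊆ ker ε, and for each α ∈ π set N_α = r_α⁻¹(A_α ⊗ R). Then each N_α is an A_α-sub-bimodule of A_α², and the π-graded first order differential calculus (Γ, d) with Γ_α = A_α²/N_α, canonical quotient map π_α, and d_α = π_α ∘ D_α, is left covariant. Conversely, every left covariant π-graded first order differential calculus over A is isomorphic to one obtained in this way from such a right ideal R of A₁ contained in ker ε. -/

import Mathlib

open TensorProduct

/-- The componentwise action of `R ⊗[k] S` on `M ⊗[k] N` induced by `k`-bilinear
actions `f` of `R` on `M` and `g` of `S` on `N`: `(r ⊗ s) • (m ⊗ n) = (f r m) ⊗ (g s n)`. -/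
noncomputable def tact {k : Type} [Field k] {R S M N : Type}
    [AddCommGroup R] [Module k R] [AddCommGroup S] [Module k S]
    [AddCommGroup M] [Module k M] [AddCommGroup N] [Module k N]
    (f : R →ₗ[k] M →ₗ[k] M) (g : S →ₗ[k] N →ₗ[k] N) :
    R ⊗[k] S →ₗ[k] (M ⊗[k] N) →ₗ[k] M ⊗[k] N :=
  TensorProduct.lift (LinearMap.mk₂ k (fun r s => TensorProduct.map (f r) (g s))
    (fun r r' s => by simp only [map_add, TensorProduct.map_add_left])
    (fun c r s => by simp only [map_smul, TensorProduct.map_smul_left])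
    (fun r s s' => by simp only [map_add, TensorProduct.map_add_right])
    (fun r c s => by simp only [map_smul, TensorProduct.map_smul_right]))

/-- `A_α² = ker(m_α : A_α ⊗ A_α → A_α)`. -/
noncomputable def A2sub (k R : Type) [Field k] [Ring R] [Algebra k R] :
    Submodule k (R ⊗[k] R) := LinearMap.ker (LinearMap.mul' k R)

/-- The left `R`-action on `R ⊗ R`: `c • (a ⊗ b) = (c*a) ⊗ b`, as a bilinear map. -/
noncomputable def lmulTb (k R : Type) [Field k] [Ring R] [Algebra k R] :
    R →ₗ[k] (R ⊗[k] R) →ₗ[k] R ⊗[k] R :=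
  (LinearMap.rTensorHom R) ∘ₗ (LinearMap.mul k R)

/-- The right `R`-action on `R ⊗ R`: `(a ⊗ b) • c = a ⊗ (b*c)`, as a bilinear map. -/
noncomputable def rmulTb (k R : Type) [Field k] [Ring R] [Algebra k R] :
    R →ₗ[k] (R ⊗[k] R) →ₗ[k] R ⊗[k] R :=
  (LinearMap.lTensorHom R) ∘ₗ (LinearMap.mul k R).flip

lemma lmulTb_mem_A2sub (k R : Type) [Field k] [Ring R] [Algebra k R]
    (c : R) (q : R ⊗[k] R) (hq : q ∈ A2sub k R) : lmulTb k R c q ∈ A2sub k R := by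
  have h : (LinearMap.mul' k R) ∘ₗ (lmulTb k R c)
      = (LinearMap.mulLeft k c) ∘ₗ (LinearMap.mul' k R) := by
    apply TensorProduct.ext'
    intro x y
    simp [lmulTb, mul_assoc]
  simp only [A2sub, LinearMap.mem_ker] at hq ⊢
  have := LinearMap.congr_fun h q
  simp only [LinearMap.comp_apply] at this
  rw [this, hq]
  simp

lemma rmulTb_mem_A2sub (k R : Type) [Field k] [Ring R] [Algebra k R]
    (c : R) (q : R ⊗[k] R) (hq : q ∈ A2sub k R) : rmulTb k R c q ∈ A2sub k R := by
  have h : (LinearMap.mul' k R) ∘ₗ (rmulTb k R c)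
      = (LinearMap.mulRight k c) ∘ₗ (LinearMap.mul' k R) := by
    apply TensorProduct.ext'
    intro x y
    simp [rmulTb, mul_assoc]
  simp only [A2sub, LinearMap.mem_ker] at hq ⊢
  have := LinearMap.congr_fun h q
  simp only [LinearMap.comp_apply] at this
  rw [this, hq]
  simp

/-- The map `D : R → R ⊗ R`, `D b = 1 ⊗ b - b ⊗ 1`. -/
noncomputable def Dmap (k R : Type) [Field k] [Ring R] [Algebra k R] :
    R →ₗ[k] R ⊗[k] R :=
  (TensorProduct.mk k R R) 1 - (TensorProduct.mk k R R).flip 1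

lemma Dmap_mem_A2sub (k R : Type) [Field k] [Ring R] [Algebra k R] (b : R) :
    Dmap k R b ∈ A2sub k R := by
  simp [Dmap, A2sub, LinearMap.mem_ker]

/-- Descend a bilinear action `act` of `R` on `M` to the quotient `p ⧸ (N ∩ p)` of an
action-stable submodule `p ⊆ M` by an action-stable submodule `N`. -/
noncomputable def descend {k M R : Type} [Field k] [AddCommGroup M] [Module k M]
    [AddCommGroup R] [Module k R]
    (p N : Submodule k M) (act : R →ₗ[k] M →ₗ[k] M)
    (hp : ∀ (c : R), ∀ x ∈ p, act c x ∈ p)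
    (hN : ∀ (c : R), ∀ x ∈ N, act c x ∈ N) :
    R →ₗ[k] (p ⧸ N.comap p.subtype) →ₗ[k] (p ⧸ N.comap p.subtype) where
  toFun c := Submodule.mapQ _ _ ((act c).restrict (hp c))
    (fun x hx => by
      simp only [Submodule.mem_comap, LinearMap.restrict_apply] at hx ⊢
      exact hN c _ hx)
  map_add' c c' := by
    apply Submodule.linearMap_qext
    ext x
    simp only [LinearMap.comp_apply, Submodule.mkQ_apply, Submodule.mapQ_apply,
      LinearMap.add_apply]
    rw [← Submodule.Quotient.mk_add]
    congr 1
    ext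
    simp [LinearMap.restrict_apply, map_add]
  map_smul' t c := by
    apply Submodule.linearMap_qext
    ext x
    simp only [LinearMap.comp_apply, Submodule.mkQ_apply, Submodule.mapQ_apply,
      RingHom.id_apply, LinearMap.smul_apply]
    rw [← Submodule.Quotient.mk_smul]
    congr 1
    ext
    simp [LinearMap.restrict_apply, map_smul]

/-- The differential `d = π ∘ D : R → A²/N` of the quotient first order
differential calculus. -/
noncomputable def dQ (k R : Type) [Field k] [Ring R] [Algebra k R]
    (N : Submodule k (R ⊗[k] R)) :
    R →ₗ[k] ((A2sub k R) ⧸ N.comap (A2sub k R).subtype) :=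
  (N.comap (A2sub k R).subtype).mkQ ∘ₗ
    (LinearMap.codRestrict (A2sub k R) (Dmap k R) (Dmap_mem_A2sub k R))

/-- The left action of `R` on the quotient `A²/N`. -/
noncomputable def lactQ (k R : Type) [Field k] [Ring R] [Algebra k R]
    (N : Submodule k (R ⊗[k] R))
    (hL : ∀ (c : R), ∀ x ∈ N, lmulTb k R c x ∈ N) :
    R →ₗ[k] (A2sub k R ⧸ N.comap (A2sub k R).subtype) →ₗ[k]
      (A2sub k R ⧸ N.comap (A2sub k R).subtype) :=
  descend (A2sub k R) N (lmulTb k R) (lmulTb_mem_A2sub k R) hL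

/-- The right action of `R` on the quotient `A²/N`. -/
noncomputable def ractQ (k R : Type) [Field k] [Ring R] [Algebra k R]
    (N : Submodule k (R ⊗[k] R))
    (hR : ∀ (c : R), ∀ x ∈ N, rmulTb k R c x ∈ N) :
    R →ₗ[k] (A2sub k R ⧸ N.comap (A2sub k R).subtype) →ₗ[k]
      (A2sub k R ⧸ N.comap (A2sub k R).subtype) :=
  descend (A2sub k R) N (rmulTb k R) (rmulTb_mem_A2sub k R) hR

/-- `r_α : A_α ⊗ A_α → A_α ⊗ A₁`, `a ⊗ b ↦ (a ⊗ 1)·Δ_{α,1}(b)`. -/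
noncomputable def rmap {k : Type} [Field k] {G : Type} [Group G]
    (A : G → Type) [∀ α, Ring (A α)] [∀ α, Algebra k (A α)]
    (Δ : ∀ α β γ : G, α * β = γ → (A γ →ₐ[k] A α ⊗[k] A β))
    (α : G) : (A α ⊗[k] A α) →ₗ[k] A α ⊗[k] A 1 :=
  (LinearMap.rTensor (A 1) (LinearMap.mul' k (A α))) ∘ₗ
    (TensorProduct.assoc k (A α) (A α) (A 1)).symm.toLinearMap ∘ₗ
    (LinearMap.lTensor (A α) (Δ α 1 α (mul_one α)).toLinearMap)

/-- `t_α : A_α ⊗ A_α → A₁ ⊗ A_α`, `a ⊗ b ↦ (1 ⊗ a)·Δ_{1,α}(b)`. -/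
noncomputable def tmap {k : Type} [Field k] {G : Type} [Group G]
    (A : G → Type) [∀ α, Ring (A α)] [∀ α, Algebra k (A α)]
    (Δ : ∀ α β γ : G, α * β = γ → (A γ →ₐ[k] A α ⊗[k] A β))
    (α : G) : (A α ⊗[k] A α) →ₗ[k] A 1 ⊗[k] A α :=
  (LinearMap.lTensor (A 1) (LinearMap.mul' k (A α))) ∘ₗ
    (TensorProduct.leftComm k (A α) (A 1) (A α)).toLinearMap ∘ₗ
    (LinearMap.lTensor (A α) (Δ 1 α α (one_mul α)).toLinearMap)

/-- `N_α = r_α⁻¹(A_α ⊗ R)` for a right ideal `R ⊆ A₁`. -/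
noncomputable def NofR {k : Type} [Field k] {G : Type} [Group G]
    (A : G → Type) [∀ α, Ring (A α)] [∀ α, Algebra k (A α)]
    (Δ : ∀ α β γ : G, α * β = γ → (A γ →ₐ[k] A α ⊗[k] A β))
    (Rid : Submodule k (A 1)) (α : G) : Submodule k (A α ⊗[k] A α) :=
  Submodule.comap (rmap A Δ α) (LinearMap.range (LinearMap.lTensor (A α) Rid.subtype))

section LinearAlgebra

variable {k : Type} [Field k] {M V X Y : Type}
  [AddCommGroup M] [Module k M] [AddCommGroup V] [Module k V]
  [AddCommGroup X] [Module k X] [AddCommGroup Y] [Module k Y]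

lemma exists_comp_eq_of_ker_le_ker (f : V →ₗ[k] X) (g : V →ₗ[k] Y)
    (h : LinearMap.ker f ≤ LinearMap.ker g) : ∃ u : X →ₗ[k] Y, u ∘ₗ f = g := by
  obtain ⟨u, hu⟩ := LinearMap.exists_extend
    ((LinearMap.ker f).liftQ g h ∘ₗ f.quotKerEquivRange.symm.toLinearMap)
  refine ⟨u, LinearMap.ext fun x => ?_⟩
  have := LinearMap.congr_fun hu (f.quotKerEquivRange (Submodule.Quotient.mk x))
  simpa using this

variable (M) in
lemma lTensor_eq_zero_of_ker_le_ker (f : V →ₗ[k] X) (g : V →ₗ[k] Y)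
    (h : LinearMap.ker f ≤ LinearMap.ker g) {t : M ⊗[k] V} (ht : f.lTensor M t = 0) :
    g.lTensor M t = 0 := by
  obtain ⟨u, rfl⟩ := exists_comp_eq_of_ker_le_ker f g h
  rw [LinearMap.lTensor_comp, LinearMap.comp_apply, ht, map_zero]

lemma lTensor_prod_eq_zero_iff (f : V →ₗ[k] X) (g : V →ₗ[k] Y) (t : M ⊗[k] V) :
    (f.prod g).lTensor M t = 0 ↔ f.lTensor M t = 0 ∧ g.lTensor M t = 0 := by
  constructor
  · intro h
    exact ⟨lTensor_eq_zero_of_ker_le_ker M (f.prod g) f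
        (fun x hx => (Prod.ext_iff.1 (LinearMap.mem_ker.1 hx)).1) h,
      lTensor_eq_zero_of_ker_le_ker M (f.prod g) g
        (fun x hx => (Prod.ext_iff.1 (LinearMap.mem_ker.1 hx)).2) h⟩
  · rintro ⟨hf, hg⟩
    have h : f.prod g = LinearMap.inl k X Y ∘ₗ f + LinearMap.inr k X Y ∘ₗ g := by
      ext <;> simp
    rw [h, LinearMap.lTensor_add, LinearMap.add_apply, LinearMap.lTensor_comp,
      LinearMap.lTensor_comp, LinearMap.comp_apply, LinearMap.comp_apply, hf, hg, map_zero,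
      map_zero, add_zero]

lemma mem_range_lTensor_subtype_iff (R : Submodule k V) (f : V →ₗ[k] X)
    (hR : LinearMap.ker f = R) (t : M ⊗[k] V) :
    t ∈ LinearMap.range (LinearMap.lTensor M R.subtype) ↔ f.lTensor M t = 0 := by
  rw [← lTensor_mkQ, LinearMap.mem_ker]
  exact ⟨lTensor_eq_zero_of_ker_le_ker M _ _ (by simp [hR]),
    lTensor_eq_zero_of_ker_le_ker M _ _ (by simp [hR])⟩

lemma exists_sum_fin_tmul (t : M ⊗[k] V) :
    ∃ (n : ℕ) (a : Fin n → M) (b : Fin n → V), t = ∑ i, a i ⊗ₜ[k] b i := by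
  obtain ⟨s, rfl⟩ := TensorProduct.exists_finset t
  refine ⟨s.card, fun i => (s.equivFin.symm i).1.1, fun i => (s.equivFin.symm i).1.2, ?_⟩
  rw [s.equivFin.symm.sum_comp (fun x : s => x.1.1 ⊗ₜ[k] x.1.2),
    Finset.sum_coe_sort s (fun x => x.1 ⊗ₜ[k] x.2)]

lemma lTensor_tact {P P' Q T : Type} [AddCommGroup P] [Module k P]
    [AddCommGroup P'] [Module k P'] [AddCommGroup Q] [Module k Q] [AddCommGroup T] [Module k T]
    (f : Q →ₗ[k] M →ₗ[k] M) (g : T →ₗ[k] P →ₗ[k] P) (g' : T →ₗ[k] P' →ₗ[k] P')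
    (φ : P →ₗ[k] P') (h : ∀ s x, φ (g s x) = g' s (φ x)) (u : Q ⊗[k] T) (w : M ⊗[k] P) :
    φ.lTensor M (tact f g u w) = tact f g' u (φ.lTensor M w) := by
  induction u with
  | zero => simp
  | add u v hu hv => simp [hu, hv]
  | tmul q s =>
    induction w with
    | zero => simp
    | add u v hu hv => simp only [map_add, hu, hv]
    | tmul m p => simp [tact, h]

end LinearAlgebra

lemma lmulTb_one {k R : Type} [Field k] [Ring R] [Algebra k R] (q : R ⊗[k] R) :
    lmulTb k R 1 q = q := by
  induction q with
  | zero => simp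
  | add u v hu hv => simp only [map_add, hu, hv]
  | tmul x y => simp [lmulTb]

lemma lmulTb_mul {k R : Type} [Field k] [Ring R] [Algebra k R] (a b : R) (q : R ⊗[k] R) :
    lmulTb k R (a * b) q = lmulTb k R a (lmulTb k R b q) := by
  induction q with
  | zero => simp
  | add u v hu hv => simp only [map_add, hu, hv]
  | tmul x y => simp [lmulTb, mul_assoc]

section Hopf

variable {k : Type} [Field k] {G : Type} [Group G]
  {A : G → Type} [∀ α, Ring (A α)] [∀ α, Algebra k (A α)]
  {Δ : ∀ α β γ : G, α * β = γ → (A γ →ₐ[k] A α ⊗[k] A β)}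
  {ε : A 1 →ₐ[k] k} {S : ∀ α β : G, α⁻¹ = β → (A α →ₗ[k] A β)}

/-- The axioms of a Hopf `G`-coalgebra, with coassociativity stated up to equality of indices. -/
structure IsHopfCoalgebra (Δ : ∀ α β γ : G, α * β = γ → (A γ →ₐ[k] A α ⊗[k] A β))
    (ε : A 1 →ₐ[k] k) (S : ∀ α β : G, α⁻¹ = β → (A α →ₗ[k] A β)) : Prop where
  coassoc : ∀ (α β γ δ η θ : G) (h₁ : α * β = δ) (h₂ : β * γ = η) (h₃ : δ * γ = θ)
    (h₄ : α * η = θ) (x : A θ),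
    (Δ β γ η h₂).toLinearMap.lTensor (A α) (Δ α η θ h₄ x) =
      TensorProduct.assoc k (A α) (A β) (A γ)
        ((Δ α β δ h₁).toLinearMap.rTensor (A γ) (Δ δ γ θ h₃ x))
  counit_right : ∀ (α : G) (x : A α),
    TensorProduct.rid k (A α) (ε.toLinearMap.lTensor (A α) (Δ α 1 α (mul_one α) x)) = x
  counit_left : ∀ (α : G) (x : A α),
    TensorProduct.lid k (A α) (ε.toLinearMap.rTensor (A α) (Δ 1 α α (one_mul α) x)) = x
  antipode_left : ∀ (α : G) (x : A 1),
    LinearMap.mul' k (A α) ((S α⁻¹ α (inv_inv α)).rTensor (A α)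
      (Δ α⁻¹ α 1 (inv_mul_cancel α) x)) = ε x • 1
  antipode_right : ∀ (α : G) (x : A 1),
    LinearMap.mul' k (A α) ((S α⁻¹ α (inv_inv α)).lTensor (A α)
      (Δ α α⁻¹ 1 (mul_inv_cancel α) x)) = ε x • 1

lemma rmap_tmul (α : G) (a b : A α) :
    rmap A Δ α (a ⊗ₜ b) = (a ⊗ₜ 1) * Δ α 1 α (mul_one α) b := by
  simp only [rmap, LinearMap.comp_apply, LinearMap.lTensor_tmul, AlgHom.toLinearMap_apply,
    LinearEquiv.coe_coe]
  induction Δ α 1 α (mul_one α) b with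
  | zero => simp
  | add u v hu hv => simp only [TensorProduct.tmul_add, map_add, hu, hv, mul_add]
  | tmul x y => simp

lemma rmap_lmulTb (α : G) (c : A α) (q : A α ⊗[k] A α) :
    rmap A Δ α (lmulTb k (A α) c q) = (c ⊗ₜ 1) * rmap A Δ α q := by
  induction q with
  | zero => simp
  | add u v hu hv => simp only [map_add, hu, hv, mul_add]
  | tmul a b => simp [lmulTb, rmap_tmul, ← mul_assoc]

lemma rmap_rmulTb (α : G) (c : A α) (q : A α ⊗[k] A α) :
    rmap A Δ α (rmulTb k (A α) c q) = rmap A Δ α q * Δ α 1 α (mul_one α) c := by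
  induction q with
  | zero => simp
  | add u v hu hv => simp only [map_add, hu, hv, add_mul]
  | tmul a b => simp [rmulTb, rmap_tmul, ← mul_assoc]

/-- The inverse of `rmap`, sending `a ⊗ x` to `(a ⊗ 1) · (S ⊗ id)(Δ x)`. -/
noncomputable def rinv (A : G → Type) [∀ α, Ring (A α)] [∀ α, Algebra k (A α)]
    (Δ : ∀ α β γ : G, α * β = γ → (A γ →ₐ[k] A α ⊗[k] A β))
    (S : ∀ α β : G, α⁻¹ = β → (A α →ₗ[k] A β)) (α : G) :
    (A α ⊗[k] A 1) →ₗ[k] A α ⊗[k] A α :=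
  (LinearMap.mul' k (A α)).rTensor (A α) ∘ₗ
    (TensorProduct.assoc k (A α) (A α) (A α)).symm.toLinearMap ∘ₗ
    ((S α⁻¹ α (inv_inv α)).rTensor (A α) ∘ₗ
      (Δ α⁻¹ α 1 (inv_mul_cancel α)).toLinearMap).lTensor (A α)

lemma rinv_tmul (α : G) (a : A α) (x : A 1) :
    rinv A Δ S α (a ⊗ₜ x) = lmulTb k (A α) a
      ((S α⁻¹ α (inv_inv α)).rTensor (A α) (Δ α⁻¹ α 1 (inv_mul_cancel α) x)) := by
  simp only [rinv, LinearMap.comp_apply, LinearMap.lTensor_tmul, AlgHom.toLinearMap_apply,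
    LinearEquiv.coe_coe]
  induction (S α⁻¹ α (inv_inv α)).rTensor (A α) (Δ α⁻¹ α 1 (inv_mul_cancel α) x) with
  | zero => simp
  | add u v hu hv => simp only [TensorProduct.tmul_add, map_add, hu, hv]
  | tmul x y => simp [lmulTb]

lemma rinv_mul (α : G) (a : A α) (t : A α ⊗[k] A 1) :
    rinv A Δ S α ((a ⊗ₜ 1) * t) = lmulTb k (A α) a (rinv A Δ S α t) := by
  induction t with
  | zero => simp
  | add u v hu hv => simp only [map_add, mul_add, hu, hv]
  | tmul x y => simp only [Algebra.TensorProduct.tmul_mul_tmul, one_mul, rinv_tmul, lmulTb_mul]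

namespace IsHopfCoalgebra

lemma rmap_rinv (H : IsHopfCoalgebra Δ ε S) (α : G) (t : A α ⊗[k] A 1) :
    rmap A Δ α (rinv A Δ S α t) = t := by
  have key : ∀ u : A α⁻¹ ⊗[k] A α,
      rmap A Δ α ((S α⁻¹ α (inv_inv α)).rTensor (A α) u) =
      (LinearMap.mul' k (A α) ∘ₗ (S α⁻¹ α (inv_inv α)).rTensor (A α)).rTensor (A 1)
        ((TensorProduct.assoc k _ _ _).symm
          ((Δ α 1 α (mul_one α)).toLinearMap.lTensor (A α⁻¹) u)) := by
    intro u
    induction u with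
    | zero => simp
    | add u v hu hv => simp only [map_add, hu, hv]
    | tmul x y =>
      simp only [LinearMap.rTensor_tmul, LinearMap.lTensor_tmul, rmap_tmul,
        AlgHom.toLinearMap_apply]
      induction Δ α 1 α (mul_one α) y with
      | zero => simp
      | add u v hu hv => simp only [TensorProduct.tmul_add, mul_add, map_add, hu, hv]
      | tmul x y => simp
  induction t with
  | zero => simp
  | add u v hu hv => simp only [map_add, hu, hv]
  | tmul a x =>
    rw [rinv_tmul, rmap_lmulTb, key,
      H.coassoc α⁻¹ α 1 1 α 1 (inv_mul_cancel α) (mul_one α) (mul_one 1) (inv_mul_cancel α),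
      LinearEquiv.symm_apply_apply]
    have h : ∀ v : A 1 ⊗[k] A 1,
        (LinearMap.mul' k (A α) ∘ₗ (S α⁻¹ α (inv_inv α)).rTensor (A α)).rTensor (A 1)
          ((Δ α⁻¹ α 1 (inv_mul_cancel α)).toLinearMap.rTensor (A 1) v) =
        1 ⊗ₜ TensorProduct.lid k (A 1) (ε.toLinearMap.rTensor (A 1) v) := by
      intro v
      induction v with
      | zero => simp
      | add u v hu hv => simp only [map_add, hu, hv, TensorProduct.tmul_add]
      | tmul x y =>
        simp [H.antipode_left, TensorProduct.smul_tmul]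
    rw [h, H.counit_left]
    simp

lemma rinv_rmap (H : IsHopfCoalgebra Δ ε S) (α : G) (t : A α ⊗[k] A α) :
    rinv A Δ S α (rmap A Δ α t) = t := by
  have key : ∀ v : A α ⊗[k] A 1, rinv A Δ S α v =
      (LinearMap.mul' k (A α) ∘ₗ (S α⁻¹ α (inv_inv α)).lTensor (A α)).rTensor (A α)
        ((TensorProduct.assoc k _ _ _).symm
          ((Δ α⁻¹ α 1 (inv_mul_cancel α)).toLinearMap.lTensor (A α) v)) := by
    intro v
    induction v with
    | zero => simp
    | add u v hu hv => simp only [map_add, hu, hv]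
    | tmul x y =>
      simp only [rinv_tmul, LinearMap.lTensor_tmul, AlgHom.toLinearMap_apply]
      induction Δ α⁻¹ α 1 (inv_mul_cancel α) y with
      | zero => simp
      | add u v hu hv => simp only [TensorProduct.tmul_add, map_add, hu, hv]
      | tmul x y => simp [lmulTb]
  induction t with
  | zero => simp
  | add u v hu hv => simp only [map_add, hu, hv]
  | tmul a b =>
    rw [rmap_tmul, rinv_mul, key,
      H.coassoc α α⁻¹ α 1 1 α (mul_inv_cancel α) (inv_mul_cancel α) (one_mul α) (mul_one α),
      LinearEquiv.symm_apply_apply]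
    have h : ∀ v : A 1 ⊗[k] A α,
        (LinearMap.mul' k (A α) ∘ₗ (S α⁻¹ α (inv_inv α)).lTensor (A α)).rTensor (A α)
          ((Δ α α⁻¹ 1 (mul_inv_cancel α)).toLinearMap.rTensor (A α) v) =
        1 ⊗ₜ TensorProduct.lid k (A α) (ε.toLinearMap.rTensor (A α) v) := by
      intro v
      induction v with
      | zero => simp
      | add u v hu hv => simp only [map_add, hu, hv, TensorProduct.tmul_add]
      | tmul x y =>
        simp [H.antipode_right, TensorProduct.smul_tmul]
    rw [h, H.counit_left]
    simp [lmulTb]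

lemma lTensor_counit_rmap (H : IsHopfCoalgebra Δ ε S) (α : G) (q : A α ⊗[k] A α) :
    TensorProduct.rid k (A α) (ε.toLinearMap.lTensor (A α) (rmap A Δ α q)) =
      LinearMap.mul' k (A α) q := by
  induction q with
  | zero => simp
  | add u v hu hv => simp only [map_add, hu, hv]
  | tmul a b =>
    have h : ∀ v : A α ⊗[k] A 1,
        TensorProduct.rid k (A α) (ε.toLinearMap.lTensor (A α) ((a ⊗ₜ 1) * v)) =
          a * TensorProduct.rid k (A α) (ε.toLinearMap.lTensor (A α) v) := by
      intro v
      induction v with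
      | zero => simp
      | add u v hu hv => simp only [map_add, mul_add, hu, hv]
      | tmul x y => simp
    rw [rmap_tmul, h, H.counit_right, LinearMap.mul'_apply]

lemma antipode_one (H : IsHopfCoalgebra Δ ε S) (α : G) :
    S α⁻¹ α (inv_inv α) 1 = 1 := by
  simpa [Algebra.TensorProduct.one_def] using H.antipode_left α 1

end IsHopfCoalgebra

end Hopf

section Calculus

variable {k R Γ : Type} [Field k] [Ring R] [Algebra k R] [AddCommGroup Γ] [Module k Γ]

/-- The map `R ⊗ R → Γ`, `a ⊗ b ↦ a · d b`, attached to a first order differential calculus. -/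
noncomputable def pmap (sl : R →ₗ[k] Γ →ₗ[k] Γ) (d : R →ₗ[k] Γ) : R ⊗[k] R →ₗ[k] Γ :=
  TensorProduct.lift (sl.compl₂ d)

@[simp] lemma pmap_tmul (sl : R →ₗ[k] Γ →ₗ[k] Γ) (d : R →ₗ[k] Γ) (a b : R) :
    pmap sl d (a ⊗ₜ b) = sl a (d b) := by
  simp [pmap]

lemma pmap_lmulTb {sl : R →ₗ[k] Γ →ₗ[k] Γ} (hmul : ∀ a b x, sl (a * b) x = sl a (sl b x))
    (d : R →ₗ[k] Γ) (c : R) (q : R ⊗[k] R) :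
    pmap sl d (lmulTb k R c q) = sl c (pmap sl d q) := by
  induction q with
  | zero => simp
  | add u v hu hv => simp only [map_add, hu, hv]
  | tmul x y => simp [lmulTb, hmul]

lemma pmap_rmulTb {sl sr : R →ₗ[k] Γ →ₗ[k] Γ} {d : R →ₗ[k] Γ}
    (hmul : ∀ a b x, sl (a * b) x = sl a (sl b x))
    (hslr : ∀ a b x, sl a (sr b x) = sr b (sl a x))
    (hd : ∀ a b, d (a * b) = sr b (d a) + sl a (d b)) (c : R) (q : R ⊗[k] R) :
    pmap sl d (rmulTb k R c q) = sr c (pmap sl d q) + sl (LinearMap.mul' k R q) (d c) := by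
  induction q with
  | zero => simp
  | add u v hu hv => simp only [map_add, hu, hv, LinearMap.add_apply]; abel
  | tmul x y => simp [rmulTb, hmul, hd, hslr]

lemma d_one_eq_zero {sl sr : R →ₗ[k] Γ →ₗ[k] Γ} {d : R →ₗ[k] Γ}
    (hsl : ∀ x, sl 1 x = x) (hsr : ∀ x, sr 1 x = x)
    (hd : ∀ a b, d (a * b) = sr b (d a) + sl a (d b)) : d 1 = 0 := by
  simpa [hsl, hsr] using hd 1 1

lemma exists_mem_A2sub_pmap_eq {sl : R →ₗ[k] Γ →ₗ[k] Γ} {d : R →ₗ[k] Γ} (hd : d 1 = 0)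
    (hgen : ∀ x, x ∈ Submodule.span k {y : Γ | ∃ a b : R, y = sl a (d b)}) (x : Γ) :
    ∃ q ∈ A2sub k R, pmap sl d q = x := by
  have h : Submodule.span k {y : Γ | ∃ a b : R, y = sl a (d b)} ≤
      (A2sub k R).map (pmap sl d) := by
    rw [Submodule.span_le]
    rintro _ ⟨a, b, rfl⟩
    exact ⟨a ⊗ₜ b - (a * b) ⊗ₜ 1, by simp [A2sub], by simp [hd]⟩
  exact h (hgen x)

variable {N : Submodule k (R ⊗[k] R)}
  (hL : ∀ (c : R), ∀ x ∈ N, lmulTb k R c x ∈ N) (hR : ∀ (c : R), ∀ x ∈ N, rmulTb k R c x ∈ N)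

lemma lactQ_mk (c : R) (x : A2sub k R) :
    lactQ k R N hL c (Submodule.Quotient.mk x) =
      Submodule.Quotient.mk ⟨lmulTb k R c x, lmulTb_mem_A2sub k R c x x.2⟩ := rfl

lemma ractQ_mk (c : R) (x : A2sub k R) :
    ractQ k R N hR c (Submodule.Quotient.mk x) =
      Submodule.Quotient.mk ⟨rmulTb k R c x, rmulTb_mem_A2sub k R c x x.2⟩ := rfl

lemma lactQ_one (x : A2sub k R ⧸ N.comap (A2sub k R).subtype) : lactQ k R N hL 1 x = x := by
  obtain ⟨x, rfl⟩ := Submodule.Quotient.mk_surjective _ x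
  rw [lactQ_mk]
  congr 1
  exact Subtype.ext (lmulTb_one _)

lemma lactQ_mul (a b : R) (x : A2sub k R ⧸ N.comap (A2sub k R).subtype) :
    lactQ k R N hL (a * b) x = lactQ k R N hL a (lactQ k R N hL b x) := by
  obtain ⟨x, rfl⟩ := Submodule.Quotient.mk_surjective _ x
  rw [lactQ_mk, lactQ_mk, lactQ_mk]
  congr 1
  exact Subtype.ext (lmulTb_mul _ _ _)

lemma dQ_mul (a b : R) :
    dQ k R N (a * b) = ractQ k R N hR b (dQ k R N a) + lactQ k R N hL a (dQ k R N b) := by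
  change Submodule.Quotient.mk _ = Submodule.Quotient.mk _ + Submodule.Quotient.mk _
  rw [← Submodule.Quotient.mk_add]
  congr 1
  apply Subtype.ext
  simp [Dmap, rmulTb, lmulTb]

/-- The projection `q ↦ q - m(q) ⊗ 1` of `R ⊗ R` onto `ker m`. -/
noncomputable def projA2 (k R : Type) [Field k] [Ring R] [Algebra k R] :
    R ⊗[k] R →ₗ[k] A2sub k R :=
  LinearMap.codRestrict (A2sub k R)
    (LinearMap.id - (TensorProduct.mk k R R).flip 1 ∘ₗ LinearMap.mul' k R)
    (fun q => by simp [A2sub])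

lemma coe_projA2 (q : R ⊗[k] R) : (projA2 k R q : R ⊗[k] R) = q - LinearMap.mul' k R q ⊗ₜ 1 :=
  rfl

lemma projA2_coe (x : A2sub k R) : projA2 k R x = x := by
  apply Subtype.ext
  rw [coe_projA2, LinearMap.mem_ker.1 x.2, TensorProduct.zero_tmul, sub_zero]

lemma pmap_lactQ (q : R ⊗[k] R) :
    pmap (lactQ k R N hL) (dQ k R N) q = Submodule.Quotient.mk (projA2 k R q) := by
  induction q with
  | zero => simp
  | add u v hu hv => simp only [map_add, hu, hv, Submodule.Quotient.mk_add]
  | tmul a b =>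
    rw [pmap_tmul]
    change Submodule.Quotient.mk _ = _
    congr 1
    apply Subtype.ext
    simp [coe_projA2, Dmap, lmulTb]

lemma mem_span_lactQ_dQ (x : A2sub k R ⧸ N.comap (A2sub k R).subtype) :
    x ∈ Submodule.span k {y | ∃ a b : R, y = lactQ k R N hL a (dQ k R N b)} := by
  obtain ⟨x, rfl⟩ := Submodule.Quotient.mk_surjective _ x
  rw [← projA2_coe x, ← pmap_lactQ hL]
  induction (x : R ⊗[k] R) with
  | zero => simp
  | add u v hu hv => rw [map_add]; exact add_mem hu hv
  | tmul a b => exact Submodule.subset_span ⟨a, b, by simp⟩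

end Calculus

section Covariance

variable {k : Type} [Field k] {G : Type} [Group G]
  {A : G → Type} [∀ α, Ring (A α)] [∀ α, Algebra k (A α)]
  {Δ : ∀ α β γ : G, α * β = γ → (A γ →ₐ[k] A α ⊗[k] A β)}
  {ε : A 1 →ₐ[k] k} {S : ∀ α β : G, α⁻¹ = β → (A α →ₗ[k] A β)}

/-- The left coaction on the universal calculus: `a ⊗ b ↦ Δ(a) · (id ⊗ (1 ⊗ ·))(Δ(b))`. -/
noncomputable def coact (Δ : ∀ α β γ : G, α * β = γ → (A γ →ₐ[k] A α ⊗[k] A β))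
    (α β γ : G) (h : α * β = γ) : A γ ⊗[k] A γ →ₗ[k] A α ⊗[k] (A β ⊗[k] A β) :=
  TensorProduct.lift
    ((tact (LinearMap.mul k (A α)) (lmulTb k (A β)) ∘ₗ (Δ α β γ h).toLinearMap).compl₂
      ((TensorProduct.mk k (A β) (A β) 1).lTensor (A α) ∘ₗ (Δ α β γ h).toLinearMap))

lemma coact_tmul (α β γ : G) (h : α * β = γ) (a b : A γ) :
    coact Δ α β γ h (a ⊗ₜ b) = tact (LinearMap.mul k (A α)) (lmulTb k (A β)) (Δ α β γ h a)
      ((TensorProduct.mk k (A β) (A β) 1).lTensor (A α) (Δ α β γ h b)) := by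
  simp [coact]

lemma lTensor_pmap_coact_tmul {Γ : Type} [AddCommGroup Γ] [Module k Γ] (α β γ : G)
    (h : α * β = γ) {sl : A β →ₗ[k] Γ →ₗ[k] Γ} (hone : ∀ x, sl 1 x = x)
    (hmul : ∀ a b x, sl (a * b) x = sl a (sl b x)) (d : A β →ₗ[k] Γ) (a b : A γ) :
    (pmap sl d).lTensor (A α) (coact Δ α β γ h (a ⊗ₜ b)) =
      tact (LinearMap.mul k (A α)) sl (Δ α β γ h a) (d.lTensor (A α) (Δ α β γ h b)) := by
  rw [coact_tmul, lTensor_tact _ _ sl (pmap sl d) (fun s x => pmap_lmulTb hmul d s x),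
    ← LinearMap.comp_apply (LinearMap.lTensor _ _) (LinearMap.lTensor _ _),
    ← LinearMap.lTensor_comp]
  congr 3
  ext x
  simp [hone]

lemma IsHopfCoalgebra.lTensor_rmap_coact (H : IsHopfCoalgebra Δ ε S) (α β γ : G)
    (h : α * β = γ) (q : A γ ⊗[k] A γ) :
    (rmap A Δ β).lTensor (A α) (coact Δ α β γ h q) =
      TensorProduct.assoc k (A α) (A β) (A 1)
        ((Δ α β γ h).toLinearMap.rTensor (A 1) (rmap A Δ γ q)) := by
  induction q with
  | zero => simp
  | add u v hu hv => simp only [map_add, hu, hv]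
  | tmul a b =>
    have h₁ : ∀ u v : A α ⊗[k] A β,
        (rmap A Δ β).lTensor (A α) (tact (LinearMap.mul k (A α)) (lmulTb k (A β)) u
          ((TensorProduct.mk k (A β) (A β) 1).lTensor (A α) v)) =
        Algebra.TensorProduct.assoc k k k (A α) (A β) (A 1) (u ⊗ₜ 1) *
          (Δ β 1 β (mul_one β)).toLinearMap.lTensor (A α) v := by
      intro u v
      induction u with
      | zero => simp
      | add u u' hu hu' =>
        simp only [map_add, TensorProduct.add_tmul, LinearMap.add_apply, hu, hu', add_mul]
      | tmul x y =>
        induction v with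
        | zero => simp
        | add v v' hv hv' => simp only [map_add, hv, hv', mul_add]
        | tmul z w => simp [tact, lmulTb, rmap_tmul]
    have h₂ : ∀ v : A γ ⊗[k] A 1,
        (Δ α β γ h).toLinearMap.rTensor (A 1) ((a ⊗ₜ 1) * v) =
        (Δ α β γ h a ⊗ₜ 1) * (Δ α β γ h).toLinearMap.rTensor (A 1) v := by
      intro v
      induction v with
      | zero => simp
      | add v v' hv hv' => simp only [map_add, hv, hv', mul_add]
      | tmul z w => simp
    rw [coact_tmul, h₁, rmap_tmul, h₂,
      H.coassoc α β 1 γ β γ h (mul_one β) (mul_one γ) h]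
    exact (map_mul (Algebra.TensorProduct.assoc k k k (A α) (A β) (A 1)) _ _).symm

lemma IsHopfCoalgebra.lTensor_coact_eq_zero (H : IsHopfCoalgebra Δ ε S)
    {X P : Type} [AddCommGroup X] [Module k X] [AddCommGroup P] [Module k P]
    (ψ : A 1 →ₗ[k] X) (α β γ : G) (h : α * β = γ) (p : A β ⊗[k] A β →ₗ[k] P)
    (hp : ∀ q, ψ.lTensor (A β) (rmap A Δ β q) = 0 → p q = 0)
    (q : A γ ⊗[k] A γ) (hq : ψ.lTensor (A γ) (rmap A Δ γ q) = 0) :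
    p.lTensor (A α) (coact Δ α β γ h q) = 0 := by
  have key : ∀ v : A γ ⊗[k] A 1,
      (ψ.lTensor (A β)).lTensor (A α) (TensorProduct.assoc k (A α) (A β) (A 1)
        ((Δ α β γ h).toLinearMap.rTensor (A 1) v)) =
      TensorProduct.assoc k (A α) (A β) X
        ((Δ α β γ h).toLinearMap.rTensor X (ψ.lTensor (A γ) v)) := by
    intro v
    induction v with
    | zero => simp
    | add v v' hv hv' => simp only [map_add, hv, hv']
    | tmul z w =>
      simp only [LinearMap.rTensor_tmul, LinearMap.lTensor_tmul, AlgHom.toLinearMap_apply]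
      induction Δ α β γ h z with
      | zero => simp
      | add v v' hv hv' => simp only [TensorProduct.add_tmul, map_add, hv, hv']
      | tmul z w => simp
  refine lTensor_eq_zero_of_ker_le_ker (A α) (ψ.lTensor (A β) ∘ₗ rmap A Δ β) _
    (fun x hx => hp x hx) ?_
  rw [LinearMap.lTensor_comp, LinearMap.comp_apply, H.lTensor_rmap_coact, key, hq,
    map_zero, map_zero]

variable {Γ : G → Type} [∀ α, AddCommGroup (Γ α)] [∀ α, Module k (Γ α)]
  {sl : ∀ α, A α →ₗ[k] Γ α →ₗ[k] Γ α} {d : ∀ α, A α →ₗ[k] Γ α}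

/-- The Maurer–Cartan type map `A₁ → Γ_α`, `x ↦ S(x₁) · d(x₂)`. -/
noncomputable def omegaMap (Δ : ∀ α β γ : G, α * β = γ → (A γ →ₐ[k] A α ⊗[k] A β))
    (S : ∀ α β : G, α⁻¹ = β → (A α →ₗ[k] A β)) (sl : ∀ α, A α →ₗ[k] Γ α →ₗ[k] Γ α)
    (d : ∀ α, A α →ₗ[k] Γ α) (α : G) : A 1 →ₗ[k] Γ α :=
  pmap (sl α) (d α) ∘ₗ rinv A Δ S α ∘ₗ TensorProduct.mk k (A α) (A 1) 1

lemma pmap_rinv_tmul (hmul : ∀ α (a b : A α) x, sl α (a * b) x = sl α a (sl α b x)) (α : G)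
    (a : A α) (x : A 1) :
    pmap (sl α) (d α) (rinv A Δ S α (a ⊗ₜ x)) = sl α a (omegaMap Δ S sl d α x) := by
  simp [omegaMap, rinv_tmul, lmulTb_one, pmap_lmulTb (hmul α)]

namespace IsHopfCoalgebra

lemma lTensor_pmap_rinv_eq_zero
    (H : IsHopfCoalgebra Δ ε S)
    (hcov : ∀ (α β γ : G) (h : α * β = γ) (q : A γ ⊗[k] A γ), pmap (sl γ) (d γ) q = 0 →
      (pmap (sl β) (d β)).lTensor (A α) (coact Δ α β γ h q) = 0)
    (α β γ : G) (h : α * β = γ) (t : A γ ⊗[k] A 1)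
    (ht : pmap (sl γ) (d γ) (rinv A Δ S γ t) = 0) :
    (pmap (sl β) (d β) ∘ₗ rinv A Δ S β).lTensor (A α)
      (TensorProduct.assoc k (A α) (A β) (A 1)
        ((Δ α β γ h).toLinearMap.rTensor (A 1) t)) = 0 := by
  have h₁ := H.lTensor_rmap_coact α β γ h (rinv A Δ S γ t)
  rw [H.rmap_rinv] at h₁
  rw [← h₁, ← LinearMap.comp_apply, ← LinearMap.lTensor_comp, LinearMap.comp_assoc,
    show rinv A Δ S β ∘ₗ rmap A Δ β = LinearMap.id from LinearMap.ext (H.rinv_rmap β),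
    LinearMap.comp_id]
  exact hcov α β γ h _ ht

lemma ker_omegaMap_one_le
    (H : IsHopfCoalgebra Δ ε S) (hone : ∀ α x, sl α 1 x = x)
    (hmul : ∀ α (a b : A α) x, sl α (a * b) x = sl α a (sl α b x))
    (hcov : ∀ (α β γ : G) (h : α * β = γ) (q : A γ ⊗[k] A γ), pmap (sl γ) (d γ) q = 0 →
      (pmap (sl β) (d β)).lTensor (A α) (coact Δ α β γ h q) = 0)
    (α : G) :
    LinearMap.ker (omegaMap Δ S sl d 1) ≤ LinearMap.ker (omegaMap Δ S sl d α) := by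
  intro x hx
  have h := H.lTensor_pmap_rinv_eq_zero hcov α⁻¹ α 1 (inv_mul_cancel α) (1 ⊗ₜ x)
    (by rw [pmap_rinv_tmul hmul, LinearMap.mem_ker.1 hx, map_zero])
  rw [LinearMap.rTensor_tmul, AlgHom.toLinearMap_apply, map_one,
    Algebra.TensorProduct.one_def, TensorProduct.assoc_tmul, LinearMap.lTensor_tmul,
    LinearMap.comp_apply, pmap_rinv_tmul hmul, hone] at h
  simpa [H.antipode_one, hone] using
    congrArg (TensorProduct.lift (sl α ∘ₗ S α⁻¹ α (inv_inv α))) h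

lemma ker_pmap_rinv_one_le
    (H : IsHopfCoalgebra Δ ε S) (hone : ∀ α x, sl α 1 x = x)
    (hmul : ∀ α (a b : A α) x, sl α (a * b) x = sl α a (sl α b x))
    (hcov : ∀ (α β γ : G) (h : α * β = γ) (q : A γ ⊗[k] A γ), pmap (sl γ) (d γ) q = 0 →
      (pmap (sl β) (d β)).lTensor (A α) (coact Δ α β γ h q) = 0) :
    LinearMap.ker (pmap (sl 1) (d 1) ∘ₗ rinv A Δ S 1) ≤
      LinearMap.ker (omegaMap Δ S sl d 1 ∘ₗ (TensorProduct.lid k (A 1)).toLinearMap ∘ₗ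
        ε.toLinearMap.rTensor (A 1)) := by
  intro t ht
  have key : ∀ v : A 1 ⊗[k] A 1,
      TensorProduct.lift (sl 1 ∘ₗ S 1⁻¹ 1 (inv_inv 1))
        ((pmap (sl 1) (d 1) ∘ₗ rinv A Δ S 1).lTensor (A 1⁻¹)
          (TensorProduct.assoc k (A 1⁻¹) (A 1) (A 1)
            ((Δ 1⁻¹ 1 1 (inv_mul_cancel 1)).toLinearMap.rTensor (A 1) v))) =
      omegaMap Δ S sl d 1 (TensorProduct.lid k (A 1) (ε.toLinearMap.rTensor (A 1) v)) := by
    intro v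
    induction v with
    | zero => simp
    | add v v' hv hv' => simp only [map_add, hv, hv']
    | tmul a x =>
      have h := congrArg (fun y => sl 1 y (omegaMap Δ S sl d 1 x)) (H.antipode_left 1 a)
      simp only [map_smul, LinearMap.smul_apply, hone] at h
      simp only [LinearMap.rTensor_tmul, AlgHom.toLinearMap_apply, TensorProduct.lid_tmul,
        map_smul, ← h]
      induction Δ 1⁻¹ 1 1 (inv_mul_cancel 1) a with
      | zero => simp
      | add v v' hv hv' =>
        simp only [TensorProduct.add_tmul, map_add, LinearMap.add_apply, hv, hv']
      | tmul z w => simp [pmap_rinv_tmul hmul, hmul]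
  rw [LinearMap.mem_ker, LinearMap.comp_apply, LinearMap.comp_apply, LinearEquiv.coe_coe, ← key,
    H.lTensor_pmap_rinv_eq_zero hcov _ _ _ _ _ ht, map_zero]

lemma pmap_eq_zero_iff
    (H : IsHopfCoalgebra Δ ε S) (hone : ∀ α x, sl α 1 x = x)
    (hmul : ∀ α (a b : A α) x, sl α (a * b) x = sl α a (sl α b x))
    (hcov : ∀ (α β γ : G) (h : α * β = γ) (q : A γ ⊗[k] A γ), pmap (sl γ) (d γ) q = 0 →
      (pmap (sl β) (d β)).lTensor (A α) (coact Δ α β γ h q) = 0)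
    (α : G) (q : A α ⊗[k] A α) :
    pmap (sl α) (d α) q = 0 ↔ (omegaMap Δ S sl d 1).lTensor (A α) (rmap A Δ α q) = 0 := by
  constructor
  · intro hq
    have h := lTensor_eq_zero_of_ker_le_ker (A α) _ _ (H.ker_pmap_rinv_one_le hone hmul hcov)
      (H.lTensor_pmap_rinv_eq_zero hcov α 1 α (mul_one α) (rmap A Δ α q)
        (by rw [H.rinv_rmap, hq]))
    rw [← h]
    induction rmap A Δ α q with
    | zero => simp
    | add v v' hv hv' => simp only [map_add, ← hv, ← hv']
    | tmul a x =>
      conv_lhs => rw [LinearMap.lTensor_tmul, ← H.counit_right α a]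
      simp only [LinearMap.rTensor_tmul, AlgHom.toLinearMap_apply]
      induction Δ α 1 α (mul_one α) a with
      | zero => simp
      | add v v' hv hv' => simp only [TensorProduct.add_tmul, map_add, hv, hv']
      | tmul z w => simp [TensorProduct.smul_tmul]
  · intro hq
    have h := congrArg (TensorProduct.lift (sl α)) (lTensor_eq_zero_of_ker_le_ker (A α) _ _
      (H.ker_omegaMap_one_le hone hmul hcov α) hq)
    have key : ∀ v : A α ⊗[k] A 1, TensorProduct.lift (sl α)
        ((omegaMap Δ S sl d α).lTensor (A α) v) = pmap (sl α) (d α) (rinv A Δ S α v) := by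
      intro v
      induction v with
      | zero => simp
      | add v v' hv hv' => simp only [map_add, hv, hv']
      | tmul a x => simp [pmap_rinv_tmul hmul]
    rwa [key, H.rinv_rmap, map_zero] at h

end IsHopfCoalgebra

end Covariance

section Classification

variable {k : Type} [Field k] {G : Type} [Group G]
  {A : G → Type} [∀ α, Ring (A α)] [∀ α, Algebra k (A α)]
  {Δ : ∀ α β γ : G, α * β = γ → (A γ →ₐ[k] A α ⊗[k] A β)}
  {ε : A 1 →ₐ[k] k} {S : ∀ α β : G, α⁻¹ = β → (A α →ₗ[k] A β)}
  {R : Submodule k (A 1)}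

lemma mem_NofR_iff {X : Type} [AddCommGroup X] [Module k X] {f : A 1 →ₗ[k] X}
    (hf : LinearMap.ker f = R) {α : G} {q : A α ⊗[k] A α} :
    q ∈ NofR A Δ R α ↔ f.lTensor (A α) (rmap A Δ α q) = 0 :=
  mem_range_lTensor_subtype_iff R f hf _

lemma lmulTb_mem_NofR (α : G) (c : A α) (q : A α ⊗[k] A α) (hq : q ∈ NofR A Δ R α) :
    lmulTb k (A α) c q ∈ NofR A Δ R α := by
  obtain ⟨s, hs⟩ := hq
  change rmap A Δ α _ ∈ LinearMap.range (LinearMap.lTensor (A α) R.subtype)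
  rw [rmap_lmulTb, ← hs]
  clear hs
  induction s with
  | zero => simp
  | add u v hu hv => rw [map_add, mul_add]; exact add_mem hu hv
  | tmul a x => exact ⟨(c * a) ⊗ₜ x, by simp⟩

lemma rmulTb_mem_NofR (hR : ∀ x ∈ R, ∀ a : A 1, x * a ∈ R) (α : G) (c : A α)
    (q : A α ⊗[k] A α) (hq : q ∈ NofR A Δ R α) : rmulTb k (A α) c q ∈ NofR A Δ R α := by
  obtain ⟨s, hs⟩ := hq
  change rmap A Δ α _ ∈ LinearMap.range (LinearMap.lTensor (A α) R.subtype)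
  rw [rmap_rmulTb, ← hs]
  clear hs
  induction s with
  | zero => simp
  | add u v hu hv => rw [map_add, add_mul]; exact add_mem hu hv
  | tmul a x =>
    induction Δ α 1 α (mul_one α) c with
    | zero => simp
    | add u v hu hv => rw [mul_add]; exact add_mem hu hv
    | tmul y z => exact ⟨(a * y) ⊗ₜ ⟨x * z, hR x x.2 z⟩, by simp⟩

lemma IsHopfCoalgebra.mem_A2sub_iff (H : IsHopfCoalgebra Δ ε S) {α : G} {q : A α ⊗[k] A α} :
    q ∈ A2sub k (A α) ↔ ε.toLinearMap.lTensor (A α) (rmap A Δ α q) = 0 := by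
  rw [A2sub, LinearMap.mem_ker, ← H.lTensor_counit_rmap, LinearEquiv.map_eq_zero_iff]

lemma IsHopfCoalgebra.NofR_le_A2sub (H : IsHopfCoalgebra Δ ε S) (hR : ∀ x ∈ R, ε x = 0)
    (α : G) : NofR A Δ R α ≤ A2sub k (A α) := by
  intro q hq
  rw [H.mem_A2sub_iff]
  exact lTensor_eq_zero_of_ker_le_ker (A α) R.mkQ ε.toLinearMap
    (fun x hx => hR x (by simpa using hx)) ((mem_NofR_iff R.ker_mkQ).1 hq)

lemma IsHopfCoalgebra.pmap_lactQ_eq_zero_iff (H : IsHopfCoalgebra Δ ε S) (α : G)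
    (hL : ∀ (c : A α), ∀ x ∈ NofR A Δ R α, lmulTb k (A α) c x ∈ NofR A Δ R α)
    (q : A α ⊗[k] A α) :
    pmap (lactQ k (A α) (NofR A Δ R α) hL) (dQ k (A α) (NofR A Δ R α)) q = 0 ↔
      (R.mkQ ∘ₗ (LinearMap.id - Algebra.linearMap k (A 1) ∘ₗ ε.toLinearMap)).lTensor (A α)
        (rmap A Δ α q) = 0 := by
  rw [pmap_lactQ, Submodule.Quotient.mk_eq_zero, Submodule.mem_comap, Submodule.subtype_apply,
    mem_NofR_iff R.ker_mkQ, coe_projA2, map_sub, rmap_tmul, map_one, mul_one,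
    ← H.lTensor_counit_rmap, LinearMap.lTensor_comp, LinearMap.comp_apply]
  congr! 2
  induction rmap A Δ α q with
  | zero => simp
  | add u v hu hv => simp only [map_add, ← hu, ← hv, TensorProduct.add_tmul]; abel
  | tmul a x =>
    simp [TensorProduct.smul_tmul, Algebra.algebraMap_eq_smul_one]

lemma IsHopfCoalgebra.lTensor_tact_lactQ_eq_zero (H : IsHopfCoalgebra Δ ε S)
    (hL : ∀ (α : G) (c : A α), ∀ x ∈ NofR A Δ R α, lmulTb k (A α) c x ∈ NofR A Δ R α)
    (α β : G) (n : ℕ) (a b : Fin n → A (α * β))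
    (h : ∑ i, lactQ k (A (α * β)) (NofR A Δ R (α * β)) (hL (α * β)) (a i)
      (dQ k (A (α * β)) (NofR A Δ R (α * β)) (b i)) = 0) :
    ∑ i, tact (LinearMap.mul k (A α)) (lactQ k (A β) (NofR A Δ R β) (hL β))
      ((Δ α β (α * β) rfl) (a i))
      ((LinearMap.lTensor (A α) (dQ k (A β) (NofR A Δ R β))) ((Δ α β (α * β) rfl) (b i))) = 0 := by
  have h₁ := H.lTensor_coact_eq_zero _ α β (α * β) rfl
    (pmap (lactQ k (A β) (NofR A Δ R β) (hL β)) (dQ k (A β) (NofR A Δ R β)))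
    (fun q => (H.pmap_lactQ_eq_zero_iff β (hL β) q).2) (∑ i, a i ⊗ₜ b i)
    ((H.pmap_lactQ_eq_zero_iff (α * β) (hL (α * β)) _).1
      (by simpa only [map_sum, pmap_tmul] using h))
  simpa only [map_sum, lTensor_pmap_coact_tmul α β _ rfl (lactQ_one (hL β))
    (lactQ_mul (hL β))] using h₁

variable {Γ : G → Type} [∀ α, AddCommGroup (Γ α)] [∀ α, Module k (Γ α)]
  {sl sr : ∀ α, A α →ₗ[k] Γ α →ₗ[k] Γ α} {d : ∀ α, A α →ₗ[k] Γ α}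

lemma lTensor_pmap_coact_eq_zero_of_sum
    (hone : ∀ α x, sl α 1 x = x)
    (hmul : ∀ α (a b : A α) x, sl α (a * b) x = sl α a (sl α b x))
    (hlcov : ∀ (α β : G) (n : ℕ) (a b : Fin n → A (α * β)),
      (∑ i, sl (α * β) (a i) (d (α * β) (b i))) = 0 →
      (∑ i, tact (LinearMap.mul k (A α)) (sl β) ((Δ α β (α * β) rfl) (a i))
          ((LinearMap.lTensor (A α) (d β)) ((Δ α β (α * β) rfl) (b i)))) = 0)
    (α β γ : G) (h : α * β = γ) (q : A γ ⊗[k] A γ) (hq : pmap (sl γ) (d γ) q = 0) :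
    (pmap (sl β) (d β)).lTensor (A α) (coact Δ α β γ h q) = 0 := by
  subst h
  obtain ⟨n, a, b, rfl⟩ := exists_sum_fin_tmul q
  simp only [map_sum, lTensor_pmap_coact_tmul α β _ rfl (hone β) (hmul β)]
  exact hlcov α β n a b (by simpa only [map_sum, pmap_tmul] using hq)

/-- The right ideal of `A₁` attached to a left covariant calculus. -/
noncomputable def idealOfCalculus (Δ : ∀ α β γ : G, α * β = γ → (A γ →ₐ[k] A α ⊗[k] A β))
    (ε : A 1 →ₐ[k] k) (S : ∀ α β : G, α⁻¹ = β → (A α →ₗ[k] A β))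
    (sl : ∀ α, A α →ₗ[k] Γ α →ₗ[k] Γ α) (d : ∀ α, A α →ₗ[k] Γ α) : Submodule k (A 1) :=
  LinearMap.ker ((omegaMap Δ S sl d 1).prod ε.toLinearMap)

namespace IsHopfCoalgebra

lemma mem_NofR_idealOfCalculus_iff
    (H : IsHopfCoalgebra Δ ε S) (hone : ∀ α x, sl α 1 x = x)
    (hmul : ∀ α (a b : A α) x, sl α (a * b) x = sl α a (sl α b x))
    (hcov : ∀ (α β γ : G) (h : α * β = γ) (q : A γ ⊗[k] A γ), pmap (sl γ) (d γ) q = 0 →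
      (pmap (sl β) (d β)).lTensor (A α) (coact Δ α β γ h q) = 0)
    {α : G} {q : A α ⊗[k] A α} :
    q ∈ NofR A Δ (idealOfCalculus Δ ε S sl d) α ↔
      pmap (sl α) (d α) q = 0 ∧ q ∈ A2sub k (A α) := by
  rw [mem_NofR_iff (R := idealOfCalculus Δ ε S sl d) rfl, lTensor_prod_eq_zero_iff, H.mem_A2sub_iff,
    H.pmap_eq_zero_iff hone hmul hcov]

lemma mul_mem_idealOfCalculus
    (H : IsHopfCoalgebra Δ ε S) (hone : ∀ α x, sl α 1 x = x)
    (hmul : ∀ α (a b : A α) x, sl α (a * b) x = sl α a (sl α b x))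
    (hcov : ∀ (α β γ : G) (h : α * β = γ) (q : A γ ⊗[k] A γ), pmap (sl γ) (d γ) q = 0 →
      (pmap (sl β) (d β)).lTensor (A α) (coact Δ α β γ h q) = 0)
    (hslr : ∀ α a b x, sl α a (sr α b x) = sr α b (sl α a x))
    (hd : ∀ α a b, d α (a * b) = sr α b (d α a) + sl α a (d α b))
    (x : A 1) (hx : x ∈ idealOfCalculus Δ ε S sl d) (a : A 1) :
    x * a ∈ idealOfCalculus Δ ε S sl d := by
  set R := idealOfCalculus Δ ε S sl d with hR
  have hN : ∀ q : A 1 ⊗[k] A 1, q ∈ NofR A Δ R 1 ↔ R.mkQ.lTensor (A 1) (rmap A Δ 1 q) = 0 :=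
    fun q => mem_NofR_iff R.ker_mkQ
  have hr : ∀ (c : A 1) (q : A 1 ⊗[k] A 1), q ∈ NofR A Δ R 1 →
      rmulTb k (A 1) c q ∈ NofR A Δ R 1 := by
    intro c q hq
    rw [hR, H.mem_NofR_idealOfCalculus_iff hone hmul hcov] at hq ⊢
    refine ⟨?_, rmulTb_mem_A2sub k _ c q hq.2⟩
    rw [pmap_rmulTb (hmul 1) (hslr 1) (hd 1), hq.1, LinearMap.mem_ker.1 hq.2]
    simp
  have h₁ : rinv A Δ S 1 (1 ⊗ₜ x) ∈ NofR A Δ R 1 := by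
    rw [hN, H.rmap_rinv, LinearMap.lTensor_tmul, Submodule.mkQ_apply,
      (Submodule.Quotient.mk_eq_zero R).2 hx, TensorProduct.tmul_zero]
  have h₂ : ∀ q : A 1 ⊗[k] A 1,
      R.mkQ.lTensor (A 1) ((1 ⊗ₜ x) * rmap A Δ 1 q) = 0 := by
    intro q
    induction q with
    | zero => simp
    | add u v hu hv => rw [map_add, mul_add, map_add, hu, hv, add_zero]
    | tmul b c =>
      have h₃ := (hN _).1 (lmulTb_mem_NofR 1 b _ (hr c _ h₁))
      rwa [rmap_lmulTb, rmap_rmulTb, H.rmap_rinv, ← mul_assoc,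
        Algebra.TensorProduct.tmul_mul_tmul, mul_one, one_mul,
        show b ⊗ₜ[k] x = ((1 : A 1) ⊗ₜ[k] x) * (b ⊗ₜ[k] (1 : A 1)) by simp, mul_assoc,
        ← rmap_tmul] at h₃
  have h₄ := h₂ (rinv A Δ S 1 (1 ⊗ₜ a))
  rw [H.rmap_rinv, Algebra.TensorProduct.tmul_mul_tmul, mul_one, LinearMap.lTensor_tmul] at h₄
  have h₅ := congrArg (fun t => TensorProduct.lid k _ (ε.toLinearMap.rTensor _ t)) h₄
  simpa using h₅

end IsHopfCoalgebra

/-- The isomorphism `A²/N ≃ Γ` induced by `a ⊗ b ↦ a · d b` when `N` is its kernel on `A²`. -/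
noncomputable def quotientEquiv {R Γ : Type} [Ring R] [Algebra k R] [AddCommGroup Γ] [Module k Γ]
    (sl : R →ₗ[k] Γ →ₗ[k] Γ) (d : R →ₗ[k] Γ) (N : Submodule k (R ⊗[k] R))
    (hN : ∀ q, q ∈ N ↔ pmap sl d q = 0 ∧ q ∈ A2sub k R)
    (hsurj : ∀ x, ∃ q ∈ A2sub k R, pmap sl d q = x) :
    (A2sub k R ⧸ N.comap (A2sub k R).subtype) ≃ₗ[k] Γ :=
  (Submodule.quotEquivOfEq _ (LinearMap.ker (pmap sl d ∘ₗ (A2sub k R).subtype))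
      (by ext x; simp [hN])).trans
    (LinearMap.quotKerEquivOfSurjective _
      fun x => let ⟨q, hq, h⟩ := hsurj x; ⟨⟨q, hq⟩, h⟩)

lemma quotientEquiv_mk {R Γ : Type} [Ring R] [Algebra k R] [AddCommGroup Γ] [Module k Γ]
    (sl : R →ₗ[k] Γ →ₗ[k] Γ) (d : R →ₗ[k] Γ) (N : Submodule k (R ⊗[k] R))
    (hN : ∀ q, q ∈ N ↔ pmap sl d q = 0 ∧ q ∈ A2sub k R)
    (hsurj : ∀ x, ∃ q ∈ A2sub k R, pmap sl d q = x) (x : A2sub k R) :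
    quotientEquiv sl d N hN hsurj (Submodule.Quotient.mk x) = pmap sl d x := rfl

end Classification

/-- Classification of left covariant `π`-graded first order
differential calculi: for a right ideal `R ⊆ ker ε` of `A₁`, the family
`N_α = r_α⁻¹(A_α ⊗ R)` consists of sub-bimodules of `A_α²` and the quotient calculus
`(A²/N, π ∘ D)` is left covariant; conversely, every left covariant `π`-graded first
order differential calculus over `A` is isomorphic to one of this form. -/
theorem left_covariant_fodc_classification
    {k : Type} [Field k] {G : Type} [Group G]
    (A : G → Type) [∀ α, Ring (A α)] [∀ α, Algebra k (A α)]
    (Δ : ∀ α β γ : G, α * β = γ → (A γ →ₐ[k] A α ⊗[k] A β))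
    (ε : A 1 →ₐ[k] k)
    (S : ∀ α β : G, α⁻¹ = β → (A α →ₗ[k] A β))
    (hcoassoc : ∀ (α β γ : G) (x : A (α * β * γ)),
      (TensorProduct.assoc k (A α) (A β) (A γ))
          ((Algebra.TensorProduct.map (Δ α β (α * β) rfl) (AlgHom.id k (A γ)))
            ((Δ (α * β) γ (α * β * γ) rfl) x))
        = (Algebra.TensorProduct.map (AlgHom.id k (A α)) (Δ β γ (β * γ) rfl))
            ((Δ α (β * γ) (α * β * γ) (mul_assoc α β γ).symm) x))
    (hcounit₁ : ∀ (α : G) (x : A α),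
      (TensorProduct.rid k (A α)) ((LinearMap.lTensor (A α) ε.toLinearMap)
        ((Δ α 1 α (mul_one α)) x)) = x)
    (hcounit₂ : ∀ (α : G) (x : A α),
      (TensorProduct.lid k (A α)) ((LinearMap.rTensor (A α) ε.toLinearMap)
        ((Δ 1 α α (one_mul α)) x)) = x)
    (hantipode₁ : ∀ (α : G) (x : A 1),
      (LinearMap.mul' k (A α)) ((LinearMap.rTensor (A α) (S α⁻¹ α (inv_inv α)))
        ((Δ α⁻¹ α 1 (inv_mul_cancel α)) x)) = ε x • 1)
    (hantipode₂ : ∀ (α : G) (x : A 1),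
      (LinearMap.mul' k (A α)) ((LinearMap.lTensor (A α) (S α⁻¹ α (inv_inv α)))
        ((Δ α α⁻¹ 1 (mul_inv_cancel α)) x)) = ε x • 1)
    -- a right ideal `R` of `A₁` contained in `ker ε`
    (Rid : Submodule k (A 1))
    (hRid_ideal : ∀ x ∈ Rid, ∀ a : A 1, x * a ∈ Rid)
    (hRid_ker : ∀ x ∈ Rid, ε x = 0)
    -- an arbitrary left covariant π-graded first order differential calculus
    (Γ : G → Type) [∀ α, AddCommGroup (Γ α)] [∀ α, Module k (Γ α)]
    (sl sr : ∀ α, A α →ₗ[k] Γ α →ₗ[k] Γ α)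
    (hsl_one : ∀ (α : G) (x : Γ α), sl α 1 x = x)
    (hsl_mul : ∀ (α : G) (a b : A α) (x : Γ α), sl α (a * b) x = sl α a (sl α b x))
    (hsr_one : ∀ (α : G) (x : Γ α), sr α 1 x = x)
    (hsr_mul : ∀ (α : G) (a b : A α) (x : Γ α), sr α (a * b) x = sr α b (sr α a x))
    (hslr : ∀ (α : G) (a b : A α) (x : Γ α), sl α a (sr α b x) = sr α b (sl α a x))
    (d : ∀ α, A α →ₗ[k] Γ α)
    (hLeibniz : ∀ (α : G) (a b : A α), d α (a * b) = sr α b (d α a) + sl α a (d α b))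
    (hgen : ∀ (α : G) (x : Γ α),
      x ∈ Submodule.span k {y : Γ α | ∃ a b : A α, y = sl α a (d α b)})
    (hlcov : ∀ (α β : G) (n : ℕ) (a b : Fin n → A (α * β)),
      (∑ i, sl (α * β) (a i) (d (α * β) (b i))) = 0 →
      (∑ i, tact (LinearMap.mul k (A α)) (sl β) ((Δ α β (α * β) rfl) (a i))
          ((LinearMap.lTensor (A α) (d β)) ((Δ α β (α * β) rfl) (b i)))) = 0) :
    -- Forward: each `N_α` is a sub-bimodule of `A_α²` and the quotient calculus is
    -- left covariant.
    ((∀ α : G, NofR A Δ Rid α ≤ A2sub k (A α))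
      ∧ ∃ (hL : ∀ (α : G) (c : A α), ∀ x ∈ NofR A Δ Rid α,
            lmulTb k (A α) c x ∈ NofR A Δ Rid α)
          (hR : ∀ (α : G) (c : A α), ∀ x ∈ NofR A Δ Rid α,
            rmulTb k (A α) c x ∈ NofR A Δ Rid α),
        (∀ (α : G) (a b : A α),
          dQ k (A α) (NofR A Δ Rid α) (a * b)
            = ractQ k (A α) (NofR A Δ Rid α) (hR α) b
                (dQ k (A α) (NofR A Δ Rid α) a)
              + lactQ k (A α) (NofR A Δ Rid α) (hL α) a
                  (dQ k (A α) (NofR A Δ Rid α) b))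
        ∧ (∀ (α : G) (x : A2sub k (A α) ⧸
              (NofR A Δ Rid α).comap (A2sub k (A α)).subtype),
            x ∈ Submodule.span k {y | ∃ a b : A α,
              y = lactQ k (A α) (NofR A Δ Rid α) (hL α) a
                    (dQ k (A α) (NofR A Δ Rid α) b)})
        ∧ (∀ (α β : G) (n : ℕ) (a b : Fin n → A (α * β)),
          (∑ i, lactQ k (A (α * β)) (NofR A Δ Rid (α * β)) (hL (α * β)) (a i)
            (dQ k (A (α * β)) (NofR A Δ Rid (α * β)) (b i))) = 0 →
          (∑ i, tact (LinearMap.mul k (A α)) (lactQ k (A β) (NofR A Δ Rid β) (hL β))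
              ((Δ α β (α * β) rfl) (a i))
              ((LinearMap.lTensor (A α) (dQ k (A β) (NofR A Δ Rid β)))
                ((Δ α β (α * β) rfl) (b i)))) = 0))
    ∧
    -- Converse: every left covariant π-graded first order differential
    -- calculus arises, up to isomorphism, from such a right ideal.
    (∃ Rid' : Submodule k (A 1),
      (∀ x ∈ Rid', ∀ a : A 1, x * a ∈ Rid')
      ∧ (∀ x ∈ Rid', ε x = 0)
      ∧ (∀ α : G, NofR A Δ Rid' α ≤ A2sub k (A α))
      ∧ ∃ (hL : ∀ (α : G) (c : A α), ∀ x ∈ NofR A Δ Rid' α,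
            lmulTb k (A α) c x ∈ NofR A Δ Rid' α)
          (hR : ∀ (α : G) (c : A α), ∀ x ∈ NofR A Δ Rid' α,
            rmulTb k (A α) c x ∈ NofR A Δ Rid' α)
          (e : ∀ α : G, (A2sub k (A α) ⧸
            (NofR A Δ Rid' α).comap (A2sub k (A α)).subtype) ≃ₗ[k] Γ α),
        (∀ (α : G) (c : A α) x,
          e α (lactQ k (A α) (NofR A Δ Rid' α) (hL α) c x) = sl α c (e α x))
        ∧ (∀ (α : G) (c : A α) x,
          e α (ractQ k (A α) (NofR A Δ Rid' α) (hR α) c x) = sr α c (e α x))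
        ∧ (∀ (α : G) (a : A α),
          e α (dQ k (A α) (NofR A Δ Rid' α) a) = d α a)) := by
  have H : IsHopfCoalgebra Δ ε S :=
    { coassoc := by
        intro α β γ δ η θ h₁ h₂ h₃ h₄ x
        subst h₁ h₂ h₃
        exact (hcoassoc α β γ x).symm
      counit_right := hcounit₁
      counit_left := hcounit₂
      antipode_left := hantipode₁
      antipode_right := hantipode₂ }
  refine ⟨⟨H.NofR_le_A2sub hRid_ker, lmulTb_mem_NofR, rmulTb_mem_NofR hRid_ideal,
    fun α a b => dQ_mul _ _ a b, fun α x => mem_span_lactQ_dQ _ x,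
    H.lTensor_tact_lactQ_eq_zero lmulTb_mem_NofR⟩, ?_⟩
  have hcov := lTensor_pmap_coact_eq_zero_of_sum hsl_one hsl_mul hlcov
  have hideal := H.mul_mem_idealOfCalculus hsl_one hsl_mul hcov hslr hLeibniz
  have hd_one : ∀ α, d α 1 = 0 := fun α => d_one_eq_zero (hsl_one α) (hsr_one α) (hLeibniz α)
  have hker : ∀ x ∈ idealOfCalculus Δ ε S sl d, ε x = 0 :=
    fun x hx => (Prod.ext_iff.1 (LinearMap.mem_ker.1 hx)).2
  refine ⟨idealOfCalculus Δ ε S sl d, hideal, hker, H.NofR_le_A2sub hker, lmulTb_mem_NofR,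
    rmulTb_mem_NofR hideal,
    fun α => quotientEquiv (sl α) (d α) _
      (fun q => H.mem_NofR_idealOfCalculus_iff hsl_one hsl_mul hcov)
      (exists_mem_A2sub_pmap_eq (hd_one α) (hgen α)), ?_, ?_, ?_⟩
  · intro α c x
    obtain ⟨x, rfl⟩ := Submodule.Quotient.mk_surjective _ x
    rw [lactQ_mk, quotientEquiv_mk, quotientEquiv_mk]
    exact pmap_lmulTb (hsl_mul α) (d α) c x
  · intro α c x
    obtain ⟨x, rfl⟩ := Submodule.Quotient.mk_surjective _ x
    rw [ractQ_mk, quotientEquiv_mk, quotientEquiv_mk]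
    have h := pmap_rmulTb (hsl_mul α) (hslr α) (hLeibniz α) c (x : A α ⊗[k] A α)
    rwa [LinearMap.mem_ker.1 x.2, map_zero, LinearMap.zero_apply, add_zero] at h
  · intro α a
    change quotientEquiv _ _ _ _ _ (Submodule.Quotient.mk _) = _
    rw [quotientEquiv_mk]
    change pmap (sl α) (d α) (Dmap k (A α) a) = d α a
    simp [Dmap, hd_one, hsl_one]
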